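/- For every t > 0, the kernel ⟨u|v⟩_t = exp(-t·4π·(λ coth λ - 1)) on the Lobachevsky space 𝓛₃, where λ is the hyperbolic angle between u and v, is positive definite: for all n, u₁,…,u_n ∈ 𝓛₃ and α₁,…,α_n ∈ ℂ, Σᵢⱼ \overline{αᵢ}αⱼ ⟨uᵢ|uⱼ⟩_t ≥ 0. -/

import Mathlib

open scoped ComplexOrder

/-- Minkowski bilinear form on `ℝ⁴` with signature `(+,-,-,-)`. -/
def mink (u v : Fin 4 → ℝ) : ℝ :=
  u 0 * v 0 - u 1 * v 1 - u 2 * v 2 - u 3 * v 3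

/-- The Lobachevsky space `𝓛₃`. -/
def Lob : Set (Fin 4 → ℝ) := {u | mink u u = 1 ∧ 0 < u 0}

/-- Inverse hyperbolic cosine: `arcosh x = log (x + √(x² - 1))`. -/
noncomputable def arcosh (x : ℝ) : ℝ := Real.log (x + Real.sqrt (x ^ 2 - 1))

/-- `λ coth λ`, interpreted as `1` at `λ = 0`. -/
noncomputable def lcoth (l : ℝ) : ℝ :=
  if l = 0 then 1 else l * (Real.cosh l / Real.sinh l)

/-- The kernel `⟨u|v⟩_t = exp (-4πt (λ coth λ - 1))`, `cosh λ = u·v`. -/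
noncomputable def kerT (t : ℝ) (u v : Fin 4 → ℝ) : ℝ :=
  Real.exp (-(t * (4 * Real.pi)) * (lcoth (arcosh (mink u v)) - 1))

open MeasureTheory Set Filter Topology

/-- The Hadamard exponential of a real positive semidefinite matrix is positive semidefinite. -/
theorem Matrix.PosSemidef.map_exp {ι : Type*} [Fintype ι] {M : Matrix ι ι ℝ}
    (hM : M.PosSemidef) : (M.map Real.exp).PosSemidef := by
  have hpow : ∀ k : ℕ, (M.map (· ^ k)).PosSemidef := by
    intro k
    induction k with
    | zero =>
      convert! Matrix.posSemidef_vecMulVec_self_star (fun _ : ι => (1 : ℝ)) using 1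
      ext i j
      simp [Matrix.vecMulVec]
    | succ k ih =>
      convert! ih.hadamard hM using 1
  refine .of_dotProduct_mulVec_nonneg ?_ fun x => ?_
  · ext i j
    simpa using congrArg Real.exp (hM.isHermitian.apply i j)
  · have hs : HasSum (fun k : ℕ => ((k.factorial : ℝ)⁻¹) * (star x ⬝ᵥ (M.map (· ^ k)).mulVec x))
        (star x ⬝ᵥ (M.map Real.exp).mulVec x) := by
      simp only [dotProduct, Matrix.mulVec, Finset.mul_sum]
      refine hasSum_sum fun i _ => hasSum_sum fun j _ => ?_
      have h := (NormedSpace.expSeries_div_hasSum_exp (M i j)).mul_left (star x i * x j)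
      rw [← Real.exp_eq_exp_ℝ] at h
      convert! h using 1
      · ext k
        simp only [Matrix.map_apply]
        ring
      · simp only [Matrix.map_apply]
        ring
    exact hs.nonneg fun k => mul_nonneg (by positivity) ((hpow k).dotProduct_mulVec_nonneg x)

/-- The complex Hermitian form of a real positive semidefinite matrix is nonnegative. -/
theorem Matrix.PosSemidef.sum_conj_mul_nonneg {ι : Type*} [Fintype ι] {M : Matrix ι ι ℝ}
    (hM : M.PosSemidef) (α : ι → ℂ) :
    (0 : ℂ) ≤ ∑ i, ∑ j, (starRingEnd ℂ) (α i) * α j * (M i j : ℂ) := by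
  have hquad : ∀ x : ι → ℝ, 0 ≤ ∑ i, ∑ j, x i * x j * M i j := by
    intro x
    have h := hM.dotProduct_mulVec_nonneg x
    simp only [dotProduct, Matrix.mulVec, Finset.mul_sum] at h
    refine h.trans_eq (Finset.sum_congr rfl fun i _ => Finset.sum_congr rfl fun j _ => ?_)
    simp only [Pi.star_apply, star_trivial]
    ring
  rw [Complex.nonneg_iff]
  constructor
  · have h := add_nonneg (hquad fun i => (α i).re) (hquad fun i => (α i).im)
    rw [← Finset.sum_add_distrib] at h
    simp only [← Finset.sum_add_distrib] at h
    simp only [Complex.re_sum]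
    convert! h using 4
    simp
    ring
  · have hsymm : ∑ i, ∑ j, (α i).im * (α j).re * M i j = ∑ i, ∑ j, (α i).re * (α j).im * M i j := by
      rw [Finset.sum_comm]
      refine Finset.sum_congr rfl fun i _ => Finset.sum_congr rfl fun j _ => ?_
      have : M j i = M i j := by simpa using hM.isHermitian.apply i j
      rw [this]
      ring
    rw [← sub_eq_zero, ← Finset.sum_sub_distrib] at hsymm
    simp only [← Finset.sum_sub_distrib] at hsymm
    simp only [Complex.im_sum]
    rw [eq_comm, ← neg_eq_zero, ← hsymm, ← Finset.sum_neg_distrib]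
    simp only [← Finset.sum_neg_distrib]
    refine Finset.sum_congr rfl fun i _ => Finset.sum_congr rfl fun j _ => ?_
    simp
    ring

/-- Feynman's parametrization of the reciprocal of a product. -/
theorem integral_inv_sq_segment {a b : ℝ} (ha : 0 < a) (hb : 0 < b) :
    ∫ x in (0 : ℝ)..1, ((x * a + (1 - x) * b) ^ 2)⁻¹ = (a * b)⁻¹ := by
  have hpos : ∀ x ∈ uIcc (0 : ℝ) 1, 0 < x * a + (1 - x) * b := by
    intro x hx
    rw [uIcc_of_le zero_le_one] at hx
    obtain ⟨h0, h1⟩ := hx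
    rcases h0.eq_or_lt with rfl | h0
    · simpa using hb
    · have : 0 ≤ (1 - x) * b := mul_nonneg (by linarith) hb.le
      positivity
  rw [intervalIntegral.integral_eq_sub_of_hasDerivAt
    (f := fun x => x / (b * (x * a + (1 - x) * b)))]
  · field_simp
    simp
  · intro x hx
    have hp := hpos x hx
    have h2 : HasDerivAt (fun x : ℝ => b * (x * a + (1 - x) * b)) (b * (1 * a + (-1) * b)) x :=
      (((hasDerivAt_id x).mul_const a).add
        (((hasDerivAt_id x).const_sub 1).mul_const b)).const_mul b
    convert! (hasDerivAt_id x).div h2 (by positivity) using 1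
    simp only [id]
    field_simp
    ring
  · refine ContinuousOn.intervalIntegrable (ContinuousOn.inv₀ (by fun_prop) fun x hx => ?_)
    exact pow_ne_zero _ (hpos x hx).ne'

theorem mul_integral_eq_lcoth_arcosh {w : ℝ} (hw : 1 ≤ w) :
    w * ∫ x in (0 : ℝ)..1, (1 + 2 * x * (1 - x) * (w - 1))⁻¹ = lcoth (arcosh w) := by
  have hac : arcosh w = Real.arcosh w := rfl
  rcases hw.eq_or_lt with rfl | hw1
  · simp [hac, lcoth]
  rw [hac]
  have hl : 0 < Real.arcosh w := Real.arcosh_pos hw1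
  have hc : Real.cosh (Real.arcosh w) = w := Real.cosh_arcosh hw
  set l := Real.arcosh w
  have hs : 0 < Real.sinh l := Real.sinh_pos_iff.2 hl
  have hpos : ∀ c x : ℝ, x ∈ uIcc (0 : ℝ) 1 → 0 < x + (1 - x) * Real.exp c := by
    intro c x hx
    rw [uIcc_of_le zero_le_one] at hx
    obtain ⟨h0, h1⟩ := hx
    rcases h0.eq_or_lt with rfl | h0
    · simpa using Real.exp_pos c
    · have : 0 ≤ (1 - x) * Real.exp c := mul_nonneg (by linarith) (Real.exp_pos c).le
      positivity
  have hee : Real.exp l * Real.exp (-l) = 1 := by rw [← Real.exp_add]; simp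
  have hfac : ∀ x : ℝ, 1 + 2 * x * (1 - x) * (w - 1)
      = (x + (1 - x) * Real.exp l) * (x + (1 - x) * Real.exp (-l)) := by
    intro x
    rw [← hc, Real.cosh_eq]
    linear_combination (-(1 - x) ^ 2) * hee
  have h_int : ∫ x in (0 : ℝ)..1, (1 + 2 * x * (1 - x) * (w - 1))⁻¹ = l / Real.sinh l := by
    rw [intervalIntegral.integral_eq_sub_of_hasDerivAt
      (f := fun x => (Real.log (x + (1 - x) * Real.exp (-l)) -
        Real.log (x + (1 - x) * Real.exp l)) / (2 * Real.sinh l))]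
    · simp
      field_simp
      ring
    · intro x hx
      have hd : ∀ c : ℝ, HasDerivAt (fun x : ℝ => Real.log (x + (1 - x) * Real.exp c))
          ((1 + (-1) * Real.exp c) / (x + (1 - x) * Real.exp c)) x := fun c =>
        ((hasDerivAt_id x).add (((hasDerivAt_id x).const_sub 1).mul_const _)).log (hpos c x hx).ne'
      convert! ((hd (-l)).sub (hd l)).div_const (2 * Real.sinh l) using 1
      have h1 := hpos l x hx
      have h2 := hpos (-l) x hx
      rw [hfac]
      have hs2 : 2 * Real.sinh l = Real.exp l - Real.exp (-l) := by rw [Real.sinh_eq]; ring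
      have hs3 : 0 < Real.exp l - Real.exp (-l) := by linarith
      rw [hs2, div_sub_div _ _ h2.ne' h1.ne', div_div, inv_eq_one_div,
        div_eq_div_iff (by positivity) (by positivity)]
      ring
    · refine ContinuousOn.intervalIntegrable (ContinuousOn.inv₀ (by fun_prop) fun x hx => ?_)
      rw [hfac]
      exact (mul_pos (hpos l x hx) (hpos (-l) x hx)).ne'
  rw [h_int, lcoth, if_neg hl.ne', hc]
  ring

theorem hasDerivAt_neg_inv_quadratic {p d y : ℝ} (hp : 0 < p) (hd : 0 < d) :
    HasDerivAt (fun y : ℝ => -(2 * p * (p * y ^ 2 + d))⁻¹) (y * ((p * y ^ 2 + d) ^ 2)⁻¹) y := by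
  have h0 : p * y ^ 2 + d ≠ 0 := by positivity
  have h := (((((hasDerivAt_pow 2 y).const_mul p).add_const d).const_mul (2 * p)).inv
    (by positivity)).neg
  convert! h using 1
  field_simp
  norm_num [mul_comm]

theorem tendsto_neg_inv_quadratic {p : ℝ} (d : ℝ) (hp : 0 < p) :
    Tendsto (fun y : ℝ => -(2 * p * (p * y ^ 2 + d))⁻¹) atTop (𝓝 0) := by
  rw [← neg_zero]
  refine (tendsto_inv_atTop_zero.comp ?_).neg
  refine Tendsto.const_mul_atTop (by positivity) (tendsto_atTop_add_const_right _ _ ?_)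
  exact (tendsto_pow_atTop two_ne_zero).const_mul_atTop hp

theorem integrable_inv_sq_quadratic_norm {p d : ℝ} (hp : 0 < p) (hd : 0 < d) :
    Integrable (fun z : ℂ => ((p * ‖z‖ ^ 2 + d) ^ 2)⁻¹) := by
  rw [integrable_fun_norm_addHaar volume (f := fun y : ℝ => ((p * y ^ 2 + d) ^ 2)⁻¹)]
  simp only [Complex.finrank_real_complex, Nat.add_one_sub_one, pow_one, smul_eq_mul]
  exact integrableOn_Ioi_deriv_of_nonneg' (fun y _ => hasDerivAt_neg_inv_quadratic hp hd)
    (fun y hy => mul_nonneg (mem_Ioi.1 hy).le (by positivity)) (tendsto_neg_inv_quadratic d hp)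

theorem integral_inv_sq_quadratic_norm {p d : ℝ} (hp : 0 < p) (hd : 0 < d) :
    ∫ z : ℂ, ((p * ‖z‖ ^ 2 + d) ^ 2)⁻¹ = Real.pi / (p * d) := by
  rw [integral_fun_norm_addHaar volume (fun y : ℝ => ((p * y ^ 2 + d) ^ 2)⁻¹)]
  simp only [Complex.finrank_real_complex, Nat.add_one_sub_one, pow_one, smul_eq_mul]
  rw [integral_Ioi_of_hasDerivAt_of_nonneg' (fun y _ => hasDerivAt_neg_inv_quadratic hp hd)
    (fun y hy => mul_nonneg (mem_Ioi.1 hy).le (by positivity)) (tendsto_neg_inv_quadratic d hp)]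
  simp [Measure.real]
  field_simp

/-- The future null vector with stereographic coordinate `z`. -/
noncomputable def nullVec (z : ℂ) : Fin 4 → ℝ :=
  ![1 + ‖z‖ ^ 2, 2 * z.re, 2 * z.im, ‖z‖ ^ 2 - 1]

theorem mink_nullVec (y : Fin 4 → ℝ) (z : ℂ) :
    mink y (nullVec z) = y 0 * (1 + ‖z‖ ^ 2) - y 1 * (2 * z.re) - y 2 * (2 * z.im)
      - y 3 * (‖z‖ ^ 2 - 1) := rfl

theorem continuous_mink_nullVec (y : Fin 4 → ℝ) : Continuous fun z => mink y (nullVec z) := by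
  simp only [mink_nullVec]
  fun_prop

theorem sub_pos_of_timelike {y : Fin 4 → ℝ} (hy : 0 < mink y y) (h0 : 0 < y 0) :
    0 < y 0 - y 3 := by
  unfold mink at hy
  nlinarith [sq_nonneg (y 1), sq_nonneg (y 2)]

theorem mink_nullVec_eq_quadratic {y : Fin 4 → ℝ} (hp : y 0 - y 3 ≠ 0) (z : ℂ) :
    mink y (nullVec z) =
      (y 0 - y 3) * ‖z - ⟨y 1 / (y 0 - y 3), y 2 / (y 0 - y 3)⟩‖ ^ 2
        + mink y y / (y 0 - y 3) := by
  rw [mink_nullVec, Complex.sq_norm, Complex.sq_norm, Complex.normSq_apply, Complex.normSq_apply]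
  simp only [Complex.sub_re, Complex.sub_im, mink]
  field_simp
  ring

theorem mink_nullVec_pos {y : Fin 4 → ℝ} (hy : 0 < mink y y) (h0 : 0 < y 0) (z : ℂ) :
    0 < mink y (nullVec z) := by
  have hp := sub_pos_of_timelike hy h0
  rw [mink_nullVec_eq_quadratic hp.ne']
  positivity

theorem integrable_inv_sq_mink_nullVec {y : Fin 4 → ℝ} (hy : 0 < mink y y) (h0 : 0 < y 0) :
    Integrable fun z : ℂ => (mink y (nullVec z) ^ 2)⁻¹ := by
  have hp := sub_pos_of_timelike hy h0
  simp only [mink_nullVec_eq_quadratic hp.ne']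
  exact (integrable_inv_sq_quadratic_norm hp (div_pos hy hp)).comp_sub_right _

theorem integral_inv_sq_mink_nullVec {y : Fin 4 → ℝ} (hy : 0 < mink y y) (h0 : 0 < y 0) :
    ∫ z : ℂ, (mink y (nullVec z) ^ 2)⁻¹ = Real.pi / mink y y := by
  have hp := sub_pos_of_timelike hy h0
  simp only [mink_nullVec_eq_quadratic hp.ne']
  rw [integral_sub_right_eq_self (fun z : ℂ => (((y 0 - y 3) * ‖z‖ ^ 2 +
    mink y y / (y 0 - y 3)) ^ 2)⁻¹), integral_inv_sq_quadratic_norm hp (div_pos hy hp)]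
  field_simp

theorem one_le_mink {u v : Fin 4 → ℝ} (hu : u ∈ Lob) (hv : v ∈ Lob) : 1 ≤ mink u v := by
  obtain ⟨hu, hu0⟩ := hu
  obtain ⟨hv, hv0⟩ := hv
  unfold mink at *
  have hcs : (1 + (u 1 * v 1 + u 2 * v 2 + u 3 * v 3)) ^ 2 ≤ (u 0 * v 0) ^ 2 := by
    have h1 : u 0 ^ 2 = 1 + (u 1 ^ 2 + u 2 ^ 2 + u 3 ^ 2) := by linarith
    have h2 : v 0 ^ 2 = 1 + (v 1 ^ 2 + v 2 ^ 2 + v 3 ^ 2) := by linarith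
    rw [mul_pow, h1, h2]
    nlinarith [sq_nonneg (u 1 - v 1), sq_nonneg (u 2 - v 2), sq_nonneg (u 3 - v 3),
      sq_nonneg (u 1 * v 2 - u 2 * v 1), sq_nonneg (u 1 * v 3 - u 3 * v 1),
      sq_nonneg (u 2 * v 3 - u 3 * v 2)]
  have := abs_le_of_sq_le_sq' hcs (by positivity)
  linarith [this.2]

theorem mink_comm (u v : Fin 4 → ℝ) : mink u v = mink v u := by
  unfold mink
  ring

theorem mink_segment {u v : Fin 4 → ℝ} (hu : u ∈ Lob) (hv : v ∈ Lob) (x : ℝ) :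
    mink (x • u + (1 - x) • v) (x • u + (1 - x) • v) =
      1 + 2 * x * (1 - x) * (mink u v - 1) := by
  have h1 := hu.1
  have h2 := hv.1
  simp only [mink, Pi.add_apply, Pi.smul_apply, smul_eq_mul] at *
  linear_combination x ^ 2 * h1 + (1 - x) ^ 2 * h2

theorem mink_segment_left (u v k : Fin 4 → ℝ) (x : ℝ) :
    mink (x • u + (1 - x) • v) k = x * mink u k + (1 - x) * mink v k := by
  simp only [mink, Pi.add_apply, Pi.smul_apply, smul_eq_mul]
  ring

theorem integrable_inv_mul_mink_nullVec {u v : Fin 4 → ℝ} (hu : u ∈ Lob) (hv : v ∈ Lob) :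
    Integrable fun z : ℂ => (mink u (nullVec z) * mink v (nullVec z))⁻¹ := by
  have hpos : ∀ {u : Fin 4 → ℝ}, u ∈ Lob → ∀ z, 0 < mink u (nullVec z) := fun hu =>
    mink_nullVec_pos (by rw [hu.1]; exact one_pos) hu.2
  have h_int : ∀ {u : Fin 4 → ℝ}, u ∈ Lob → Integrable fun z => (mink u (nullVec z) ^ 2)⁻¹ :=
    fun hu => integrable_inv_sq_mink_nullVec (by rw [hu.1]; exact one_pos) hu.2
  refine ((h_int hu).add (h_int hv)).mono' ?_ (.of_forall fun z => ?_)
  · exact (((continuous_mink_nullVec u).mul (continuous_mink_nullVec v)).inv₀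
      fun z => (mul_pos (hpos hu z) (hpos hv z)).ne').aestronglyMeasurable
  · have h1 := hpos hu z
    have h2 := hpos hv z
    rw [Real.norm_of_nonneg (by positivity)]
    simp only [Pi.add_apply, mul_inv, ← inv_pow]
    nlinarith [sq_nonneg ((mink u (nullVec z))⁻¹ - (mink v (nullVec z))⁻¹),
      sq_nonneg (mink u (nullVec z))⁻¹, sq_nonneg (mink v (nullVec z))⁻¹]

theorem integral_mink_div_mul_mink_nullVec {u v : Fin 4 → ℝ} (hu : u ∈ Lob) (hv : v ∈ Lob) :
    ∫ z : ℂ, mink u v * (mink u (nullVec z) * mink v (nullVec z))⁻¹ =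
      Real.pi * lcoth (arcosh (mink u v)) := by
  have hw := one_le_mink hu hv
  have hpos : ∀ {u : Fin 4 → ℝ}, u ∈ Lob → ∀ z, 0 < mink u (nullVec z) := fun hu =>
    mink_nullVec_pos (by rw [hu.1]; exact one_pos) hu.2
  have hseg : ∀ x ∈ Icc (0 : ℝ) 1, 0 < 1 + 2 * x * (1 - x) * (mink u v - 1) := by
    intro x hx
    have := mul_nonneg (mul_nonneg hx.1 (sub_nonneg.2 hx.2)) (sub_nonneg.2 hw)
    linarith
  have hseg0 : ∀ x ∈ Icc (0 : ℝ) 1, 0 < (x • u + (1 - x) • v) 0 := by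
    intro x hx
    simp only [Pi.add_apply, Pi.smul_apply, smul_eq_mul]
    have := hu.2
    have := hv.2
    rcases hx.1.eq_or_lt with h | h
    · simpa [← h]
    · have := mul_nonneg (sub_nonneg.2 hx.2) hv.2.le
      positivity
  have hx_int : ∀ x ∈ Icc (0 : ℝ) 1, Integrable fun z : ℂ =>
      ((x * mink u (nullVec z) + (1 - x) * mink v (nullVec z)) ^ 2)⁻¹ := by
    intro x hx
    simp only [← mink_segment_left]
    exact integrable_inv_sq_mink_nullVec (mink_segment hu hv x ▸ hseg x hx) (hseg0 x hx)
  have hx_val : ∀ x ∈ Icc (0 : ℝ) 1, ∫ z : ℂ,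
      ((x * mink u (nullVec z) + (1 - x) * mink v (nullVec z)) ^ 2)⁻¹ =
        Real.pi * (1 + 2 * x * (1 - x) * (mink u v - 1))⁻¹ := by
    intro x hx
    simp only [← mink_segment_left]
    rw [integral_inv_sq_mink_nullVec (mink_segment hu hv x ▸ hseg x hx) (hseg0 x hx),
      mink_segment hu hv, div_eq_mul_inv]
  have hmeas : Measurable (Function.uncurry fun (x : ℝ) (z : ℂ) =>
      ((x * mink u (nullVec z) + (1 - x) * mink v (nullVec z)) ^ 2)⁻¹) := by
    have h1 := (continuous_mink_nullVec u).measurable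
    have h2 := (continuous_mink_nullVec v).measurable
    exact (((measurable_fst.mul (h1.comp measurable_snd)).add
      ((measurable_fst.const_sub 1).mul (h2.comp measurable_snd))).pow_const 2).inv
  have hmem : ∀ᵐ x ∂(volume.restrict (Ioc (0 : ℝ) 1)), x ∈ Icc (0 : ℝ) 1 :=
    (ae_restrict_mem measurableSet_Ioc).mono fun x hx => Ioc_subset_Icc_self hx
  have hprod : Integrable (Function.uncurry fun (x : ℝ) (z : ℂ) =>
      ((x * mink u (nullVec z) + (1 - x) * mink v (nullVec z)) ^ 2)⁻¹)
      ((volume.restrict (Ioc (0 : ℝ) 1)).prod volume) := by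
    rw [integrable_prod_iff hmeas.aestronglyMeasurable]
    refine ⟨hmem.mono fun x hx => hx_int x hx, ?_⟩
    have hc : IntegrableOn (fun x : ℝ => Real.pi * (1 + 2 * x * (1 - x) * (mink u v - 1))⁻¹)
        (Ioc 0 1) :=
      (ContinuousOn.integrableOn_Icc (continuousOn_const.mul (ContinuousOn.inv₀ (by fun_prop)
        fun x hx => (hseg x hx).ne'))).mono_set Ioc_subset_Icc_self
    refine hc.congr (hmem.mono fun x hx => ?_)
    refine (hx_val x hx).symm.trans ?_
    refine integral_congr_ae (.of_forall fun z => ?_)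
    exact (Real.norm_of_nonneg (inv_nonneg.2 (sq_nonneg _))).symm
  rw [integral_const_mul, ← mul_integral_eq_lcoth_arcosh hw]
  have hfey : ∀ z, (mink u (nullVec z) * mink v (nullVec z))⁻¹ = ∫ x in Ioc (0 : ℝ) 1,
      ((x * mink u (nullVec z) + (1 - x) * mink v (nullVec z)) ^ 2)⁻¹ := fun z => by
    rw [← integral_inv_sq_segment (hpos hu z) (hpos hv z),
      intervalIntegral.integral_of_le zero_le_one]
  simp only [hfey]
  rw [← integral_integral_swap hprod, intervalIntegral.integral_of_le zero_le_one,
    integral_congr_ae (hmem.mono hx_val), integral_const_mul]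
  ring

theorem mink_self_nonpos_of_orthogonal {V k : Fin 4 → ℝ} (hk : mink k k = 0) (hk0 : k 0 ≠ 0)
    (h : mink V k = 0) : mink V V ≤ 0 := by
  unfold mink at *
  have hk2 : k 0 ^ 2 = k 1 ^ 2 + k 2 ^ 2 + k 3 ^ 2 := by linarith
  have hV : V 0 * k 0 = V 1 * k 1 + V 2 * k 2 + V 3 * k 3 := by linarith
  have hsq : V 0 ^ 2 * k 0 ^ 2 ≤ (V 1 ^ 2 + V 2 ^ 2 + V 3 ^ 2) * k 0 ^ 2 := by
    rw [← mul_pow, hV, hk2]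
    nlinarith [sq_nonneg (V 1 * k 2 - V 2 * k 1), sq_nonneg (V 1 * k 3 - V 3 * k 1),
      sq_nonneg (V 2 * k 3 - V 3 * k 2)]
  have := le_of_mul_le_mul_right hsq (by positivity)
  linarith

theorem mink_nullVec_self (z : ℂ) : mink (nullVec z) (nullVec z) = 0 := by
  have h := Complex.sq_norm z
  rw [Complex.normSq_apply] at h
  rw [mink_nullVec]
  simp only [nullVec, Matrix.cons_val]
  linear_combination 4 * h

theorem mink_sum_smul_left {ι : Type*} (s : Finset ι) (a : ι → ℝ) (V : ι → Fin 4 → ℝ)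
    (k : Fin 4 → ℝ) : mink (∑ i ∈ s, a i • V i) k = ∑ i ∈ s, a i * mink (V i) k := by
  simp only [mink, Finset.sum_apply, Pi.smul_apply, smul_eq_mul, Finset.sum_mul,
    ← Finset.sum_sub_distrib]
  exact Finset.sum_congr rfl fun i _ => by ring

theorem mink_inv_smul_sub_inv_smul (u v e : Fin 4 → ℝ) (a b c : ℝ) :
    -mink (a⁻¹ • u - c⁻¹ • e) (b⁻¹ • v - c⁻¹ • e) =
      mink u e * (a * c)⁻¹ + mink v e * (b * c)⁻¹ - mink e e * (c * c)⁻¹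
        - mink u v * (a * b)⁻¹ := by
  simp only [mink, Pi.sub_apply, Pi.smul_apply, smul_eq_mul, mul_inv]
  ring

/-- On `𝓛₃`, the function `λ coth λ` is conditionally negative definite: its Gromov product with
respect to a base point `e` is positive semidefinite. -/
theorem posSemidef_gromovProduct_lcoth {ι : Type*} [Fintype ι] {u : ι → Fin 4 → ℝ}
    (hu : ∀ i, u i ∈ Lob) {e : Fin 4 → ℝ} (he : e ∈ Lob) :
    (Matrix.of fun i j => lcoth (arcosh (mink (u i) e)) + lcoth (arcosh (mink (u j) e))
      - lcoth (arcosh (mink e e)) - lcoth (arcosh (mink (u i) (u j)))).PosSemidef := by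
  refine .of_dotProduct_mulVec_nonneg ?_ fun x => ?_
  · ext i j
    simp only [Matrix.conjTranspose_apply, Matrix.of_apply, star_trivial, mink_comm (u j) (u i)]
    ring
  set V : ℂ → ι → Fin 4 → ℝ := fun z i =>
    (mink (u i) (nullVec z))⁻¹ • u i - (mink e (nullVec z))⁻¹ • e with hV
  have hJ : ∀ {v w : Fin 4 → ℝ}, v ∈ Lob → w ∈ Lob →
      Integrable fun z : ℂ => mink v w * (mink v (nullVec z) * mink w (nullVec z))⁻¹ :=
    fun hv hw => (integrable_inv_mul_mink_nullVec hv hw).const_mul _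
  have h_int : ∀ i j, Integrable fun z => -mink (V z i) (V z j) := fun i j => by
    simp only [hV, mink_inv_smul_sub_inv_smul]
    exact (((hJ (hu i) he).add (hJ (hu j) he)).sub (hJ he he)).sub (hJ (hu i) (hu j))
  have hval : ∀ i j, ∫ z, -mink (V z i) (V z j) =
      Real.pi * (lcoth (arcosh (mink (u i) e)) + lcoth (arcosh (mink (u j) e))
        - lcoth (arcosh (mink e e)) - lcoth (arcosh (mink (u i) (u j)))) := fun i j => by
    simp only [hV, mink_inv_smul_sub_inv_smul]
    rw [integral_sub, integral_sub, integral_add (hJ (hu i) he) (hJ (hu j) he)]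
    · simp only [integral_mink_div_mul_mink_nullVec, hu, he]
      ring
    · exact (hJ (hu i) he).add (hJ (hu j) he)
    · exact hJ he he
    · exact ((hJ (hu i) he).add (hJ (hu j) he)).sub (hJ he he)
    · exact hJ (hu i) (hu j)
  have horth : ∀ z i, mink (V z i) (nullVec z) = 0 := by
    intro z i
    have hpos : ∀ {v : Fin 4 → ℝ}, v ∈ Lob → mink v (nullVec z) ≠ 0 := fun hv =>
      (mink_nullVec_pos (by rw [hv.1]; exact one_pos) hv.2 z).ne'
    have hlin : ∀ (a b : ℝ) (v w k : Fin 4 → ℝ),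
        mink (a • v - b • w) k = a * mink v k - b * mink w k := fun a b v w k => by
      simp only [mink, Pi.sub_apply, Pi.smul_apply, smul_eq_mul]
      ring
    rw [hV, hlin, inv_mul_cancel₀ (hpos (hu i)), inv_mul_cancel₀ (hpos he), sub_self]
  have hnonneg : ∀ z, 0 ≤ ∑ i, ∑ j, x i * x j * -mink (V z i) (V z j) := by
    intro z
    have hk0 : nullVec z 0 ≠ 0 := by
      have : 0 < 1 + ‖z‖ ^ 2 := by positivity
      exact this.ne'
    have h : mink (∑ i, x i • V z i) (∑ i, x i • V z i) ≤ 0 := by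
      refine mink_self_nonpos_of_orthogonal (mink_nullVec_self z) hk0 ?_
      rw [mink_sum_smul_left]
      simp [horth]
    rw [mink_sum_smul_left] at h
    simp only [mink_comm (V z _) (∑ i, x i • V z i), mink_sum_smul_left, Finset.mul_sum] at h
    rw [← neg_nonneg, ← Finset.sum_neg_distrib] at h
    simp only [← Finset.sum_neg_distrib] at h
    refine h.trans_eq (Finset.sum_congr rfl fun i _ => Finset.sum_congr rfl fun j _ => ?_)
    rw [mink_comm (V z j)]
    ring
  have hsum : ∫ z, ∑ i, ∑ j, x i * x j * -mink (V z i) (V z j) =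
      ∑ i, ∑ j, x i * x j * ∫ z, -mink (V z i) (V z j) := by
    rw [integral_finsetSum _ fun i _ => integrable_finsetSum _ fun j _ => (h_int i j).const_mul _]
    refine Finset.sum_congr rfl fun i _ => ?_
    rw [integral_finsetSum _ fun j _ => (h_int i j).const_mul _]
    exact Finset.sum_congr rfl fun j _ => integral_const_mul _ _
  have h := hsum ▸ integral_nonneg hnonneg
  simp only [hval] at h
  refine nonneg_of_mul_nonneg_right (h.trans_eq ?_) Real.pi_pos
  simp only [dotProduct, Matrix.mulVec, Finset.mul_sum, Matrix.of_apply, Pi.star_apply,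
    star_trivial]
  refine Finset.sum_congr rfl fun i _ => Finset.sum_congr rfl fun j _ => ?_
  ring

theorem posSemidef_kerT {ι : Type*} [Fintype ι] {t : ℝ} (ht : 0 ≤ t) {u : ι → Fin 4 → ℝ}
    (hu : ∀ i, u i ∈ Lob) : (Matrix.of fun i j => kerT t (u i) (u j)).PosSemidef := by
  have he : (![1, 0, 0, 0] : Fin 4 → ℝ) ∈ Lob := by simp [Lob, mink]
  set e : Fin 4 → ℝ := ![1, 0, 0, 0]
  have hee : lcoth (arcosh (mink e e)) = 1 := by
    rw [he.1]
    simp [arcosh, lcoth]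
  have hc : 0 ≤ t * (4 * Real.pi) := by positivity
  have hexp := ((posSemidef_gromovProduct_lcoth hu he).smul hc).map_exp
  have hdiag := Matrix.posSemidef_vecMulVec_self_star fun i =>
    Real.exp (-(t * (4 * Real.pi)) * (lcoth (arcosh (mink (u i) e)) - 1))
  convert! hdiag.hadamard hexp using 1
  ext i j
  simp only [Matrix.of_apply, Matrix.hadamard_apply, Matrix.vecMulVec_apply, Matrix.map_apply,
    Matrix.smul_apply, smul_eq_mul, star_trivial, ← Real.exp_add, kerT, hee]
  congr 1
  ring

/-- For every `t > 0`, the kernel `⟨u|v⟩_t = exp(-4πt(λ coth λ - 1))` is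
positive definite on the Lobachevsky space. -/
theorem kerT_positive_definite (t : ℝ) (ht : 0 < t) :
    ∀ (n : ℕ) (u : Fin n → (Fin 4 → ℝ)) (α : Fin n → ℂ),
      (∀ i, u i ∈ Lob) →
      (0 : ℂ) ≤ ∑ i, ∑ j, (starRingEnd ℂ) (α i) * α j * (kerT t (u i) (u j) : ℂ) := by
  intro n u α hu
  exact (posSemidef_kerT ht.le hu).sum_conj_mul_nonneg α
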